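/- Let G be a finite connected distance-hereditary graph, let x,y be a diametral pair with diam(G) = 2·rad(G) − 1, and let A = S_{rad(G)−1}(x,y) and B = S_{rad(G)−1}(y,x). Then the subgraph induced by C(G) is a cograph; for every edge ab with a ∈ A and b ∈ B, every vertex of C(G) is within distance 1 of {a,b}; and there exist vertices a ∈ A ∩ C(G) and b ∈ B ∩ C(G). -/

import Mathlib

/-- A graph is distance-hereditary if every connected induced subgraph is isometric
(equivalently, every induced path is a shortest path). -/
def DistHereditary {V : Type*} (G : SimpleGraph V) : Prop :=
  ∀ s : Set V, (G.induce s).Connected →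
    ∀ u v : s, (G.induce s).dist u v = G.dist (u : V) (v : V)

/-- Eccentricity of a vertex: `e(v) = max_{u} d(v,u)`. -/
noncomputable def ecc {V : Type*} [Fintype V] (G : SimpleGraph V) (v : V) : ℕ :=
  Finset.univ.sup (fun u => G.dist v u)

/-- Radius: minimum eccentricity. -/
noncomputable def rad {V : Type*} [Fintype V] (G : SimpleGraph V) : ℕ :=
  sInf (Set.range (ecc G))

/-- Diameter: maximum eccentricity. -/
noncomputable def diam {V : Type*} [Fintype V] (G : SimpleGraph V) : ℕ :=
  Finset.univ.sup (fun v => ecc G v)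

/-- The center: vertices of minimum eccentricity. -/
def center {V : Type*} [Fintype V] (G : SimpleGraph V) : Set V :=
  {v | ecc G v = rad G}

/-- Distance from a vertex to a set of vertices: `d(v,S) = min_{s ∈ S} d(v,s)`. -/
noncomputable def distToSet {V : Type*} (G : SimpleGraph V) (v : V) (S : Set V) : ℕ :=
  sInf ((G.dist v) '' S)

/-- The interval `I(x,y)`: vertices on shortest `(x,y)`-paths. -/
def interval {V : Type*} (G : SimpleGraph V) (x y : V) : Set V :=
  {v | G.dist x v + G.dist v y = G.dist x y}

/-- The intervalSlice `S_k(x,y) = {v ∈ I(x,y) : d(x,v) = k}`. -/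
def intervalSlice {V : Type*} (G : SimpleGraph V) (x y : V) (k : ℕ) : Set V :=
  {v | v ∈ interval G x y ∧ G.dist x v = k}

/-- The set `S` induces a cograph in `G`: no induced path on four vertices within `S`. -/
def IsCographOn {V : Type*} (G : SimpleGraph V) (S : Set V) : Prop :=
  ¬ ∃ a b c d : V, a ∈ S ∧ b ∈ S ∧ c ∈ S ∧ d ∈ S ∧
    a ≠ c ∧ a ≠ d ∧ b ≠ d ∧
    G.Adj a b ∧ G.Adj b c ∧ G.Adj c d ∧ ¬ G.Adj a c ∧ ¬ G.Adj a d ∧ ¬ G.Adj b d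

/-- A vertex at distance `i` from `z` on a shortest path from `z` to `w`. -/
theorem exists_dist_eq_of_le_dist {V : Type*} {G : SimpleGraph V} (hconn : G.Connected) (z w : V) (i : ℕ)
    (hi : i ≤ G.dist z w) : ∃ v, G.dist z v = i ∧ i + G.dist v w = G.dist z w := by
  obtain ⟨p, hp⟩ := hconn.exists_walk_length_eq_dist z w
  have h1 : G.dist z (p.getVert i) ≤ i := by
    refine (SimpleGraph.dist_le (p.take i)).trans ?_
    rw [SimpleGraph.Walk.take_length]
    exact min_le_left _ _
  have h2 : G.dist (p.getVert i) w ≤ G.dist z w - i := by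
    refine (SimpleGraph.dist_le (p.drop i)).trans ?_
    rw [SimpleGraph.Walk.drop_length, hp]
  have h3 := hconn.dist_triangle (u := z) (v := p.getVert i) (w := w)
  exact ⟨p.getVert i, by omega, by omega⟩

/-- Vertices on a shortest walk lie in the interval between its ends. -/
theorem dist_add_dist_of_mem_support {V : Type*} {G : SimpleGraph V} (hconn : G.Connected)
    {u w v : V} (p : G.Walk u w) (hp : p.length = G.dist u w) (hv : v ∈ p.support) :
    G.dist u v + G.dist v w = G.dist u w := by
  classical
  have h1 := SimpleGraph.dist_le (p.takeUntil v hv)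
  have h2 := SimpleGraph.dist_le (p.dropUntil v hv)
  have h3 := congrArg SimpleGraph.Walk.length (p.take_spec hv)
  rw [SimpleGraph.Walk.length_append] at h3
  have h4 := hconn.dist_triangle (u := u) (v := v) (w := w)
  omega

/-- In a distance-hereditary graph, adjacent vertices farther from `u` than `p` have `p` on a
shortest path from `u` simultaneously. -/
theorem DistHereditary.between_of_adj {V : Type*} {G : SimpleGraph V} (hconn : G.Connected)
    (hdh : DistHereditary G) {u p z w : V} (hzw : G.Adj z w) (hw : G.dist u p < G.dist u w)
    (h : G.dist u p + G.dist p z = G.dist u z) : G.dist u p + G.dist p w = G.dist u w := by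
  obtain ⟨P, hP⟩ := hconn.exists_walk_length_eq_dist u p
  obtain ⟨Q, hQ⟩ := hconn.exists_walk_length_eq_dist p z
  let W := (P.append Q).concat hzw
  have hconnW : (G.induce {v | v ∈ W.support}).Connected := W.connected_induce_support
  have hdist := hdh _ hconnW ⟨u, W.start_mem_support⟩ ⟨w, W.end_mem_support⟩
  simp only at hdist
  obtain ⟨v, hv1, hv2⟩ := exists_dist_eq_of_le_dist hconnW ⟨u, W.start_mem_support⟩
    ⟨w, W.end_mem_support⟩ (G.dist u p) (by omega)
  have e1 := hdh _ hconnW ⟨u, W.start_mem_support⟩ v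
  have e2 := hdh _ hconnW v ⟨w, W.end_mem_support⟩
  simp only at e1 e2
  have hv : (v : V) ∈ W.support := v.2
  have hvp : (v : V) = p := by
    simp only [W, SimpleGraph.Walk.support_concat, List.mem_append,
      SimpleGraph.Walk.mem_support_append_iff, List.mem_singleton] at hv
    rcases hv with (hv | hv) | hv
    · have := dist_add_dist_of_mem_support hconn P hP hv
      exact hconn.dist_eq_zero_iff.1 (by omega)
    · have h1 := dist_add_dist_of_mem_support hconn Q hQ hv
      have h2 := hconn.dist_triangle (u := u) (v := v) (w := z)
      exact (hconn.dist_eq_zero_iff.1 (by omega)).symm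
    · rw [hv] at e1
      omega
  rw [hvp] at e2
  omega

/-- The same, for vertices joined by a shortest path that stays farther from `u` than `p`. -/
theorem DistHereditary.between_of_geodesic {V : Type*} {G : SimpleGraph V} (hconn : G.Connected)
    (hdh : DistHereditary G) {u p z w : V}
    (hfar : ∀ v, G.dist z v + G.dist v w = G.dist z w → G.dist u p < G.dist u v)
    (h : G.dist u p + G.dist p z = G.dist u z) : G.dist u p + G.dist p w = G.dist u w := by
  induction hn : G.dist z w generalizing z with
  | zero => rwa [← hconn.dist_eq_zero_iff.1 hn]
  | succ n ih =>
    obtain ⟨v, hv1, hv2⟩ := exists_dist_eq_of_le_dist hconn z w 1 (by omega)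
    refine ih (z := v) (fun t ht => hfar t ?_) ?_ (by omega)
    · have h1 := hconn.dist_triangle (u := z) (v := v) (w := t)
      have h2 := hconn.dist_triangle (u := z) (v := t) (w := w)
      omega
    · exact hdh.between_of_adj hconn (SimpleGraph.dist_eq_one_iff_adj.1 hv1)
        (hfar v (by omega)) h

/-- A distance-hereditary graph contains no gem. -/
theorem DistHereditary.not_gem {V : Type*} {G : SimpleGraph V} (hconn : G.Connected)
    (hdh : DistHereditary G) {a b c d w : V} (hac : a ≠ c) (had : a ≠ d)
    (hab : G.Adj a b) (hbc : G.Adj b c) (hcd : G.Adj c d) (nac : ¬ G.Adj a c)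
    (nad : ¬ G.Adj a d) (nbd : ¬ G.Adj b d) (hwa : G.Adj w a) (hwd : G.Adj w d) : False := by
  have dist_two : ∀ {s t v : V}, s ≠ t → ¬ G.Adj s t → G.Adj s v → G.Adj v t →
      G.dist s t = 2 := by
    intro s t v hne hnadj h1 h2
    rw [← SimpleGraph.dist_eq_one_iff_adj] at hnadj h1 h2
    have := hconn.dist_triangle (u := s) (v := v) (w := t)
    have := hconn.pos_dist_of_ne hne
    omega
  have h1 := dist_two hac nac hab hbc
  have h2 := dist_two had nad hwa.symm hwd
  have hab' := SimpleGraph.dist_eq_one_iff_adj.2 hab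
  have hbc' := SimpleGraph.dist_eq_one_iff_adj.2 hbc
  have h3 := hdh.between_of_adj hconn (u := a) (p := b) hcd (by omega) (by omega)
  exact nbd (SimpleGraph.dist_eq_one_iff_adj.1 (by omega))

/-- A vertex `b` in the middle slice on the side of `y` is adjacent to every vertex `c` at
distance `r` from `y` and at most `r` from `x`. -/
theorem DistHereditary.dist_slice_eq_one {V : Type*} {G : SimpleGraph V} (hconn : G.Connected)
    (hdh : DistHereditary G) {x y b c : V} {r : ℕ} (hxy : G.dist x y + 1 = 2 * r)
    (hyb : G.dist y b + 1 = r) (hbx : G.dist b x = r) (hyc : G.dist y c = r)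
    (hxc : G.dist x c ≤ r) : G.dist b c = 1 := by
  have hyx := G.dist_comm (u := x) (v := y)
  have := hdh.between_of_geodesic hconn (u := y) (p := b) (z := x) (w := c) (fun v hv => by
    have h1 := hconn.dist_triangle (u := x) (v := v) (w := y)
    have h2 := G.dist_comm (u := v) (v := y)
    by_cases h0 : G.dist v c = 0
    · rw [hconn.dist_eq_zero_iff.1 h0]
      omega
    · omega) (by omega)
  omega

/-- Suppose `a` is in the middle slice on the side of `x` and `b` is a neighbour of `a` in the
middle slice on the side of `y`. Then a vertex at distance more than `r` from `a` is at
distance `2r - 1` from `y` and less than `2r - 1` from `x`. -/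
theorem DistHereditary.dist_of_far_from_slice {V : Type*} {G : SimpleGraph V}
    (hconn : G.Connected) (hdh : DistHereditary G) {x y a b z : V} {r : ℕ}
    (hD : ∀ u v, G.dist u v + 1 ≤ 2 * r) (hxy : G.dist x y + 1 = 2 * r)
    (hxa : G.dist x a + 1 = r) (hay : G.dist a y = r) (hyb : G.dist y b + 1 = r)
    (hbx : G.dist b x = r) (hab : G.dist a b = 1) (haz : r < G.dist a z) :
    G.dist y z + 1 = 2 * r ∧ G.dist x z + 2 ≤ 2 * r := by
  have hyx := G.dist_comm (u := x) (v := y)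
  have hxz := hD x z
  have hyz := hD y z
  have hp : ∃ p, G.dist y p + G.dist p z = G.dist y z ∧ G.dist x p ≤ G.dist x a := by
    by_contra! hcon
    have := hdh.between_of_geodesic hconn (u := x) (p := a) hcon (by omega)
    omega
  obtain ⟨p, hp1, hp2⟩ := hp
  have h1 := hconn.dist_triangle (u := x) (v := p) (w := y)
  have h2 := hconn.dist_triangle (u := x) (v := p) (w := z)
  have h3 := G.dist_comm (u := p) (v := y)
  refine ⟨?_, by omega⟩
  by_cases hq : ∃ q, G.dist x q + G.dist q z = G.dist x z ∧ G.dist y q ≤ G.dist y b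
  · obtain ⟨q, hq1, hq2⟩ := hq
    have h4 := hconn.dist_triangle (u := y) (v := q) (w := x)
    have h5 := hconn.dist_triangle (u := y) (v := q) (w := z)
    have h6 := G.dist_comm (u := q) (v := x)
    omega
  · push Not at hq
    have h4 := hdh.between_of_geodesic hconn (u := y) (p := b) hq (by omega)
    have h5 := hconn.dist_triangle (u := a) (v := b) (w := z)
    omega

set_option maxHeartbeats 1000000 in
/-- Two vertices `z₀`, `z` at distance `2r - 1` from `y` all of whose middle slices lie next
to `b`: if `a` is in the middle slice of `z₀` and `a'` in that of `z` but not of `z₀`, then `a`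
is within distance `r` of `z`. -/
theorem DistHereditary.dist_le_of_slice_not_subset {V : Type*} {G : SimpleGraph V}
    (hconn : G.Connected) (hdh : DistHereditary G) {y b z₀ z a a' : V} {r : ℕ}
    (hD : ∀ u v, G.dist u v + 1 ≤ 2 * r)
    (hyz₀ : G.dist y z₀ + 1 = 2 * r) (hyz : G.dist y z + 1 = 2 * r)
    (hbz₀ : G.dist b z₀ = r) (hbz : G.dist b z = r)
    (hb₀ : ∀ w, G.dist y w = r → G.dist w z₀ + 1 = r → G.dist b w = 1)
    (hb : ∀ w, G.dist y w = r → G.dist w z + 1 = r → G.dist b w = 1)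
    (hya : G.dist y a = r) (haz₀ : G.dist a z₀ + 1 = r)
    (hya' : G.dist y a' = r) (haz' : G.dist a' z + 1 = r) (hna' : G.dist a' z₀ + 1 ≠ r) :
    G.dist a z ≤ r := by
  have hba := hb₀ a hya haz₀
  have hba' := hb a' hya' haz'
  by_contra! haz
  have hab := G.dist_comm (u := a) (v := b)
  have haz_eq : G.dist a z = r + 1 := by
    have := hconn.dist_triangle (u := a) (v := b) (w := z)
    omega
  have hza₀ : r ≤ G.dist a' z₀ := by
    have := hconn.dist_triangle (u := y) (v := a') (w := z₀)
    omega
  have adj_b : ∀ {w}, G.dist b w = 1 → G.Adj b w := SimpleGraph.dist_eq_one_iff_adj.1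
  have ne_r : ∀ w, G.dist y w = r → G.dist w z + 1 = r → G.dist w z₀ ≠ r := by
    intro w hyw hwz hwz₀
    have hbw := hb w hyw hwz
    have c1 := G.dist_comm (u := a) (v := z₀)
    have c2 := G.dist_comm (u := b) (v := z₀)
    have c3 := G.dist_comm (u := w) (v := z₀)
    have h1 := hdh.between_of_adj hconn (u := z₀) (p := a) (adj_b hbw) (by omega) (by omega)
    have h2 := hconn.dist_triangle (u := a) (v := w) (w := z)
    omega
  have hm : ∃ m, G.dist z m + G.dist m z₀ = G.dist z z₀ ∧ G.dist y m ≤ G.dist y a' := by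
    by_contra! hcon
    have := hdh.between_of_geodesic hconn (u := y) (p := a') hcon (by omega)
    omega
  obtain ⟨m, hm1, hm2⟩ := hm
  have c1 := G.dist_comm (u := z) (v := m)
  have hzz₀ := hD z z₀
  have t1 := hconn.dist_triangle (u := y) (v := m) (w := z)
  have t2 := hconn.dist_triangle (u := y) (v := m) (w := z₀)
  by_cases hmz : G.dist m z + 1 = r
  · have hym : G.dist y m = r := by omega
    have hmz₀ : G.dist m z₀ + 1 = r := by
      have := ne_r m hym hmz
      omega
    have hbm := hb m hym hmz
    have hr : 2 ≤ r := by
      have := hD a z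
      omega
    obtain ⟨q, hq1, hq2⟩ := exists_dist_eq_of_le_dist hconn a z₀ 1 (by omega)
    have c2 := G.dist_comm (u := a) (v := z₀)
    have c3 := G.dist_comm (u := b) (v := z₀)
    have c4 := G.dist_comm (u := m) (v := z₀)
    have c5 := G.dist_comm (u := q) (v := z₀)
    have c6 := G.dist_comm (u := q) (v := a)
    have h1 := hdh.between_of_adj hconn (u := z₀) (p := q) (adj_b hba).symm
      (by omega) (by omega)
    have h2 := hdh.between_of_adj hconn (u := z₀) (p := q) (adj_b hbm) (by omega) h1
    have t3 := hconn.dist_triangle (u := a) (v := m) (w := z)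
    have t4 := hconn.dist_triangle (u := a) (v := b) (w := m)
    have h3 := hdh.between_of_geodesic hconn (u := a) (p := q) (z := m) (w := z)
      (fun v hv => by
        have := hconn.dist_triangle (u := a) (v := v) (w := z)
        omega) (by omega)
    have c7 := G.dist_comm (u := z) (v := a')
    have h4 := hdh.between_of_geodesic hconn (u := a) (p := q) (z := z) (w := a')
      (fun v hv => by
        have := hconn.dist_triangle (u := a) (v := v) (w := z)
        have := G.dist_comm (u := v) (v := z)
        omega) (by omega)
    have t5 := hconn.dist_triangle (u := a) (v := b) (w := a')
    have t6 := hconn.dist_triangle (u := a') (v := q) (w := z₀)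
    have c8 := G.dist_comm (u := a') (v := q)
    omega
  · have hbm := hb₀ m (by omega) (by omega)
    have c2 := G.dist_comm (u := b) (v := z)
    have c3 := G.dist_comm (u := a') (v := z)
    have c4 := G.dist_comm (u := a') (v := b)
    have h1 := hdh.between_of_adj hconn (u := z) (p := a') (adj_b hbm) (by omega) (by omega)
    have t3 := hconn.dist_triangle (u := a') (v := m) (w := z₀)
    exact ne_r a' hya' haz' (by omega)

/-- If the diameter is `2r - 1`, attained by `x, y`, then the middle slice on the side of `x`
contains a vertex of eccentricity at most `r`. -/
theorem DistHereditary.exists_slice_dist_le {V : Type*} [Fintype V] {G : SimpleGraph V}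
    (hconn : G.Connected) (hdh : DistHereditary G) {x y : V} {r : ℕ}
    (hD : ∀ u v, G.dist u v + 1 ≤ 2 * r) (hxy : G.dist x y + 1 = 2 * r) :
    ∃ a, G.dist x a + 1 = r ∧ G.dist a y = r ∧ ∀ z, G.dist a z ≤ r := by
  classical
  have hyx := G.dist_comm (u := x) (v := y)
  obtain ⟨a₀, hxa₀, ha₀y⟩ := exists_dist_eq_of_le_dist hconn x y (r - 1) (by omega)
  obtain ⟨b, ha₀b, hby⟩ := exists_dist_eq_of_le_dist hconn a₀ y 1 (by omega)
  have hyb : G.dist y b + 1 = r := by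
    have := G.dist_comm (u := y) (v := b)
    omega
  have hbx : G.dist b x = r := by
    have := hconn.dist_triangle (u := x) (v := a₀) (w := b)
    have := hconn.dist_triangle (u := x) (v := b) (w := y)
    have := G.dist_comm (u := x) (v := b)
    omega
  let Z : Finset V := Finset.univ.filter fun z => G.dist y z + 1 = 2 * r ∧ G.dist x z + 2 ≤ 2 * r
  have far : ∀ a, G.dist x a + 1 = r → G.dist a y = r → ∀ z, r < G.dist a z → z ∈ Z := by
    intro a hxa hay z haz
    have hba := hdh.dist_slice_eq_one hconn (c := a) hxy hyb hbx
      (by rw [SimpleGraph.dist_comm]; exact hay) (by omega)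
    have hab := G.dist_comm (u := a) (v := b)
    simpa [Z] using hdh.dist_of_far_from_slice hconn hD hxy hxa hay hyb hbx (by omega) haz
  rcases Z.eq_empty_or_nonempty with hZ | hZ
  · refine ⟨a₀, by omega, by omega, fun z => ?_⟩
    by_contra! hz
    have := far a₀ (by omega) (by omega) z hz
    simp [hZ] at this
  have hbZ : ∀ z ∈ Z, G.dist b z = r := by
    intro z hz
    obtain ⟨hz1, hz2⟩ : G.dist y z + 1 = 2 * r ∧ G.dist x z + 2 ≤ 2 * r := by simpa [Z] using hz
    have := hdh.between_of_geodesic hconn (u := y) (p := b) (z := x) (w := z) (fun v hv => by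
      have := hconn.dist_triangle (u := y) (v := v) (w := x)
      have := hconn.dist_triangle (u := y) (v := v) (w := z)
      have := G.dist_comm (u := v) (v := x)
      omega) (by omega)
    omega
  have hbP : ∀ z ∈ Z, ∀ w, G.dist y w = r → G.dist w z + 1 = r → G.dist b w = 1 := by
    intro z hz w hyw hwz
    have hbz := hbZ z hz
    obtain ⟨hz1, hz2⟩ : G.dist y z + 1 = 2 * r ∧ G.dist x z + 2 ≤ 2 * r := by simpa [Z] using hz
    have c1 := G.dist_comm (u := w) (v := z)
    have := hdh.between_of_geodesic hconn (u := y) (p := b) (z := z) (w := w) (fun v hv => by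
      have := hconn.dist_triangle (u := y) (v := v) (w := z)
      have := G.dist_comm (u := v) (v := z)
      omega) (by omega)
    omega
  let P : V → Finset V := fun z => Finset.univ.filter fun p => G.dist y p = r ∧ G.dist p z + 1 = r
  obtain ⟨z₀, hz₀, hmin⟩ := Z.exists_min_image (fun z => (P z).card) hZ
  obtain ⟨hz1, hz2⟩ : G.dist y z₀ + 1 = 2 * r ∧ G.dist x z₀ + 2 ≤ 2 * r := by simpa [Z] using hz₀
  obtain ⟨a, hxa, hya, haz₀⟩ : ∃ a, G.dist x a + 1 = r ∧ G.dist y a = r ∧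
      G.dist a z₀ + 1 = r := by
    have c1 := G.dist_comm (u := y) (v := a₀)
    have c2 := G.dist_comm (u := x) (v := a₀)
    by_cases h : ∃ v, G.dist x v + G.dist v z₀ = G.dist x z₀ ∧ G.dist y v ≤ G.dist y a₀
    · obtain ⟨v, hv1, hv2⟩ := h
      have := hconn.dist_triangle (u := y) (v := v) (w := x)
      have := hconn.dist_triangle (u := y) (v := v) (w := z₀)
      have := G.dist_comm (u := v) (v := x)
      exact ⟨v, by omega, by omega, by omega⟩
    · push Not at h
      have := hdh.between_of_geodesic hconn (u := y) (p := a₀) h (by omega)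
      exact ⟨a₀, by omega, by omega, by omega⟩
  have hay : G.dist a y = r := by rw [SimpleGraph.dist_comm]; exact hya
  refine ⟨a, hxa, hay, fun z => ?_⟩
  by_contra! haz
  have hz := far a hxa hay z haz
  obtain ⟨hz3, -⟩ : G.dist y z + 1 = 2 * r ∧ G.dist x z + 2 ≤ 2 * r := by simpa [Z] using hz
  have hsub : ¬ P z ⊆ P z₀ := by
    intro hsub
    have ha : a ∈ P z₀ := by simp [P, hya, haz₀]
    have ha' : a ∉ P z := by
      simp only [P, Finset.mem_filter, Finset.mem_univ, true_and, not_and]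
      omega
    have := Finset.card_lt_card (Finset.ssubset_iff_subset_ne.2 ⟨hsub, fun h => ha' (h ▸ ha)⟩)
    exact absurd (hmin z hz) (by omega)
  obtain ⟨a', ha_mem, ha_not_mem⟩ := Finset.not_subset.1 hsub
  obtain ⟨hya', hza⟩ : G.dist y a' = r ∧ G.dist a' z + 1 = r := by simpa [P] using ha_mem
  have hna' : G.dist a' z₀ + 1 ≠ r := by simpa [P, hya'] using ha_not_mem
  have := hdh.dist_le_of_slice_not_subset hconn hD hz1 hz3 (hbZ z₀ hz₀) (hbZ z hz)
    (hbP z₀ hz₀) (hbP z hz) hya haz₀ hya' hza hna'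
  omega

theorem dist_le_ecc {V : Type*} [Fintype V] (G : SimpleGraph V) (u v : V) :
    G.dist u v ≤ ecc G u :=
  Finset.le_sup (f := fun w => G.dist u w) (Finset.mem_univ v)

theorem dist_le_diam {V : Type*} [Fintype V] (G : SimpleGraph V) (u v : V) :
    G.dist u v ≤ diam G :=
  (dist_le_ecc G u v).trans (Finset.le_sup (f := fun w => ecc G w) (Finset.mem_univ u))

theorem mem_center_of_dist_le {V : Type*} [Fintype V] {G : SimpleGraph V} {a : V}
    (h : ∀ z, G.dist a z ≤ rad G) : a ∈ center G :=
  le_antisymm (Finset.sup_le fun z _ => h z) (Nat.sInf_le ⟨a, rfl⟩)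

/-- Let `x,y` be a diametral pair with `diam(G) = 2·rad(G) − 1`, and let
`A = S_{rad(G)−1}(x,y)`, `B = S_{rad(G)−1}(y,x)`. Then `C(G)` induces a cograph; for every
edge `ab` with `a ∈ A`, `b ∈ B`, every vertex of `C(G)` is within distance 1 of `{a,b}`;
and there exist `a ∈ A ∩ C(G)` and `b ∈ B ∩ C(G)`. -/
theorem center_when_diam_eq_two_rad_minus_one {V : Type*} [Fintype V] (G : SimpleGraph V)
    (hconn : G.Connected) (hdh : DistHereditary G) (x y : V)
    (hdiam : G.dist x y = diam G) (h2r : diam G + 1 = 2 * rad G) :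
    IsCographOn G (center G) ∧
    (∀ a ∈ intervalSlice G x y (rad G - 1), ∀ b ∈ intervalSlice G y x (rad G - 1), G.Adj a b →
      ∀ c ∈ center G, G.dist c a ≤ 1 ∨ G.dist c b ≤ 1) ∧
    (∃ a, a ∈ intervalSlice G x y (rad G - 1) ∧ a ∈ center G) ∧
    (∃ b, b ∈ intervalSlice G y x (rad G - 1) ∧ b ∈ center G) := by
  have hD : ∀ u v, G.dist u v + 1 ≤ 2 * rad G := fun u v => by
    have := dist_le_diam G u v
    omega
  have hxy : G.dist x y + 1 = 2 * rad G := by omega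
  have hyx : G.dist y x + 1 = 2 * rad G := by rw [SimpleGraph.dist_comm]; exact hxy
  have hC : ∀ c ∈ center G, ∀ z, G.dist z c ≤ rad G := fun c hc z => by
    rw [SimpleGraph.dist_comm, ← (show ecc G c = rad G from hc)]
    exact dist_le_ecc G c z
  have hCsum : ∀ c, 2 * rad G ≤ G.dist x c + G.dist y c + 1 := fun c => by
    have := hconn.dist_triangle (u := x) (v := c) (w := y)
    have := G.dist_comm (u := y) (v := c)
    omega
  obtain ⟨a₀, hxa₀, ha₀y, ha₀⟩ := hdh.exists_slice_dist_le hconn hD hxy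
  obtain ⟨b₀, hyb₀, hb₀x, hb₀⟩ := hdh.exists_slice_dist_le hconn hD hyx
  refine ⟨?_, ?_, ⟨a₀, ⟨?_, ?_⟩, mem_center_of_dist_le ha₀⟩,
    ⟨b₀, ⟨?_, ?_⟩, mem_center_of_dist_le hb₀⟩⟩
  · rintro ⟨a, b, c, d, ha, hb, hc, hd, hac, had, -, hab, hbc, hcd, nac, nad, nbd⟩
    have one_side : ∀ {s t : V}, G.dist s t + 1 = 2 * rad G → ∀ {u v : V}, u ∈ center G →
        v ∈ center G → ¬ G.Adj u v → G.dist s u ≤ G.dist s v := by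
      intro s t hst u v hu hv hnadj
      by_contra! hlt
      have hts := G.dist_comm (u := s) (v := t)
      have h1 := hconn.dist_triangle (u := s) (v := v) (w := t)
      have h2 := G.dist_comm (u := v) (v := t)
      have h3 := hC v hv t
      have h4 := hC u hu s
      have h5 := hC u hu t
      have := hdh.dist_slice_eq_one hconn (x := t) (y := s) (b := v) (c := u) (r := rad G)
        (by omega) (by omega) (by omega) (by omega) h5
      exact hnadj (SimpleGraph.dist_eq_one_iff_adj.1 this).symm
    have x1 := one_side hxy hd ha (fun h => nad h.symm)
    have x2 := one_side hxy ha hd nad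
    have y1 := one_side hyx hd ha (fun h => nad h.symm)
    have y2 := one_side hyx ha hd nad
    have sa := hCsum a
    have hax := hC a ha x
    have hay := hC a ha y
    by_cases hy : G.dist y a = rad G
    · have e1 := hdh.dist_slice_eq_one hconn hxy hyb₀ hb₀x hy hax
      have e2 := hdh.dist_slice_eq_one hconn (c := d) hxy hyb₀ hb₀x (by omega) (by omega)
      exact hdh.not_gem hconn hac had hab hbc hcd nac nad nbd
        (SimpleGraph.dist_eq_one_iff_adj.1 e1) (SimpleGraph.dist_eq_one_iff_adj.1 e2)
    · have e1 := hdh.dist_slice_eq_one hconn (c := a) hyx hxa₀ ha₀y (by omega) hay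
      have e2 := hdh.dist_slice_eq_one hconn (c := d) hyx hxa₀ ha₀y (by omega) (by omega)
      exact hdh.not_gem hconn hac had hab hbc hcd nac nad nbd
        (SimpleGraph.dist_eq_one_iff_adj.1 e1) (SimpleGraph.dist_eq_one_iff_adj.1 e2)
  · rintro a ⟨ha1, ha2⟩ b ⟨hb1, hb2⟩ - c hc
    simp only [interval, Set.mem_ofPred_eq] at ha1 hb1
    have sc := hCsum c
    have hcx := hC c hc x
    have hcy := hC c hc y
    have c1 := G.dist_comm (u := c) (v := a)
    have c2 := G.dist_comm (u := c) (v := b)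
    by_cases hy : G.dist y c = rad G
    · have := hdh.dist_slice_eq_one hconn (b := b) hxy (by omega) (by omega) hy hcx
      omega
    · have := hdh.dist_slice_eq_one hconn (b := a) (c := c) hyx (by omega) (by omega)
        (by omega) hcy
      omega
  · simp only [interval, Set.mem_ofPred_eq]
    omega
  · omega
  · simp only [interval, Set.mem_ofPred_eq]
    omega
  · omega
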